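/- Let 0 ≤ α < 1 and let f(z) = z·h(z)·conj(g(z)) belong to S*_Lh(α). Then 1/(2^{2α}·e^{2(1−α)}) ≤ d(0, ∂(f(𝔻))) ≤ 1. -/

import Mathlib

open Complex Metric

lemma harnack_aux {K : ℂ → ℂ} {R : ℝ} (hK : DifferentiableOn ℂ K (ball 0 R)) (hK0 : K 0 = 1)
    (hpos : ∀ z ∈ ball (0:ℂ) R, 0 < (K z).re) {z : ℂ} (hz : z ∈ ball (0:ℂ) R) :
    (R - ‖z‖) / (R + ‖z‖) ≤ (K z).re := by
  have hR : 0 < R := nonempty_ball.1 ⟨z, hz⟩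
  have hne : ∀ z ∈ ball (0:ℂ) R, K z + 1 ≠ 0 := by
    intro z hz h0
    have := congrArg re h0
    have := hpos z hz
    simp at *
    linarith
  have key : ∀ z ∈ ball (0:ℂ) R, ‖K z - 1‖ ≤ ‖K z + 1‖ := by
    intro z hz
    have := hpos z hz
    rw [← sq_le_sq₀ (norm_nonneg _) (norm_nonneg _), ← normSq_eq_norm_sq, ← normSq_eq_norm_sq,
      normSq_apply, normSq_apply]
    simp
    nlinarith
  have hd : DifferentiableOn ℂ (fun z => (K z - 1) / (K z + 1)) (ball 0 R) :=
    (hK.sub_const 1).div (hK.add_const 1) hne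
  have hm : Set.MapsTo (fun z => (K z - 1) / (K z + 1)) (ball 0 R)
      (closedBall ((fun z => (K z - 1) / (K z + 1)) 0) 1) := by
    intro z hz
    simp only [hK0, sub_self, zero_div, mem_closedBall, dist_zero_right, norm_div]
    exact div_le_one_of_le₀ (key z hz) (norm_nonneg _)
  have hs := dist_le_div_mul_dist_of_mapsTo_ball hd hm hz
  simp only [hK0, sub_self, zero_div, dist_zero_right, norm_div] at hs
  have h1 : 0 < ‖K z + 1‖ := norm_pos_iff.2 (hne z hz)
  rw [div_le_iff₀ h1] at hs
  have hzR : ‖z‖ < R := by simpa using hz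
  set t := 1 / R * ‖z‖ with ht
  have ht0 : 0 ≤ t := by positivity
  have hsq : ‖K z - 1‖^2 ≤ t^2 * ‖K z + 1‖^2 := by
    rw [← mul_pow]; gcongr
  have ht1 : t < 1 := by rw [ht, one_div, inv_mul_lt_iff₀ hR]; linarith
  rw [← normSq_eq_norm_sq, ← normSq_eq_norm_sq, normSq_apply, normSq_apply] at hsq
  simp at hsq
  have ha := hpos z hz
  have h2 : ((K z).re - 1)^2 ≤ (t * ((K z).re + 1))^2 := by
    nlinarith [mul_nonneg (sub_nonneg.2 (show t^2 ≤ 1 by nlinarith)) (sq_nonneg (K z).im)]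
  have h3 := abs_le_of_sq_le_sq h2 (by positivity)
  have h4 := (abs_le.1 h3).1
  have hzt : ‖z‖ = t * R := by rw [ht]; field_simp
  rw [hzt, div_le_iff₀ (by positivity)]
  nlinarith

lemma jack_aux {G G' : ℂ → ℂ} (hG : ∀ z ∈ ball (0:ℂ) 1, HasDerivAt G (G' z) z) (hG0 : G 0 = 0)
    (hs : ∀ z ∈ ball (0:ℂ) 1, z * G' z + 1 ∈ slitPlane) {z : ℂ} (hz : z ∈ ball (0:ℂ) 1) :
    -2 ≤ (G z).re := by
  by_contra! hlt
  have hcont : ContinuousOn G (ball 0 1) := fun z hz => (hG z hz).continuousAt.continuousWithinAt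
  have hz1 : ‖z‖ < 1 := by simpa using hz
  have hsub : closedBall (0:ℂ) ‖z‖ ⊆ ball 0 1 := closedBall_subset_ball hz1
  have hcre : ContinuousOn (fun z => (G z).re) (ball 0 1) := continuous_re.comp_continuousOn hcont
  have hcomp : IsCompact (closedBall (0:ℂ) ‖z‖ ∩ (fun z => (G z).re) ⁻¹' Set.Iic (-2)) := by
    refine (isCompact_closedBall _ _).of_isClosed_subset ?_ Set.inter_subset_left
    exact (hcre.mono hsub).preimage_isClosed_of_isClosed isClosed_closedBall isClosed_Iic
  obtain ⟨z0, ⟨hz0, hz0'⟩, hmin⟩ := hcomp.exists_isMinOn ⟨z, by simp, hlt.le⟩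
    (continuous_norm.continuousOn)
  have hz0b := hsub hz0
  simp only [Set.mem_preimage, Set.mem_Iic] at hz0'
  have hgt : ∀ w ∈ ball (0:ℂ) ‖z0‖, -2 < (G w).re := by
    intro w hw
    by_contra! hc
    have hw' : ‖w‖ < ‖z0‖ := by simpa using hw
    have : w ∈ closedBall (0:ℂ) ‖z‖ := by
      simp at hz0 ⊢; linarith
    have := hmin ⟨this, hc⟩
    simp at this
    linarith
  have hz00 : z0 ≠ 0 := by
    rintro rfl; rw [hG0] at hz0'; norm_num at hz0'
  have hr0 : 0 < ‖z0‖ := norm_pos_iff.2 hz00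
  have hsub0 : closedBall (0:ℂ) ‖z0‖ ⊆ ball 0 1 := closedBall_subset_ball (by simpa using hz0b)
  have hge : ∀ w ∈ closedBall (0:ℂ) ‖z0‖, -2 ≤ (G w).re := by
    intro w hw
    have hcl : closure (ball (0:ℂ) ‖z0‖) = closedBall 0 ‖z0‖ := closure_ball _ hr0.ne'
    exact le_on_closure (f := fun _ => (-2:ℝ)) (g := fun w => (G w).re) (s := ball (0:ℂ) ‖z0‖)
      (fun w hw => (hgt w hw).le) continuousOn_const
      (by rw [hcl]; exact hcre.mono hsub0) (by rw [hcl]; exact hw)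
  have heq : (G z0).re = -2 := le_antisymm hz0' (hge z0 (by simp))
  have hdG : DifferentiableOn ℂ G (ball 0 ‖z0‖) := fun w hw =>
    (hG w (hsub0 (ball_subset_closedBall hw))).differentiableAt.differentiableWithinAt
  have him : (z0 * G' z0).im = 0 := by
    have hd : HasDerivAt (fun t : ℝ => G (exp (t * I) * z0)) (G' z0 * (I * z0)) 0 := by
      have h1 : HasDerivAt (fun t : ℝ => exp (t * I) * z0) (I * z0) 0 := by
        have := (((hasDerivAt_id (0:ℝ)).ofReal_comp.mul_const I).cexp).mul_const z0
        simpa using this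
      have h2 : HasDerivAt G (G' z0) ((fun t : ℝ => exp (t * I) * z0) 0) := by
        simpa using hG z0 hz0b
      exact h2.comp (0:ℝ) h1
    have hdr : HasDerivAt (fun t : ℝ => (G (exp (t * I) * z0)).re) (G' z0 * (I * z0)).re 0 := by
      exact reCLM.hasFDerivAt.comp_hasDerivAt (0:ℝ) hd
    have hloc : IsLocalMin (fun t : ℝ => (G (exp (t * I) * z0)).re) 0 := by
      refine Filter.Eventually.of_forall fun t => ?_
      have := hge (exp (t * I) * z0) (by simp [norm_exp_ofReal_mul_I])
      simpa [heq] using this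
    have := hloc.hasDerivAt_eq_zero hdr
    simp at this ⊢
    linarith
  have hre : (z0 * G' z0).re ≤ -1 := by
    have hd : HasDerivAt (fun t : ℝ => G (t * z0)) (G' z0 * z0) 1 := by
      have h1 : HasDerivAt (fun t : ℝ => (t:ℂ) * z0) z0 1 := by
        have := ((hasDerivAt_id (1:ℝ)).ofReal_comp).mul_const z0
        simpa using this
      have h2 : HasDerivAt G (G' z0) ((fun t : ℝ => (t:ℂ) * z0) 1) := by
        simpa using hG z0 hz0b
      exact h2.comp (1:ℝ) h1
    have hdr : HasDerivAt (fun t : ℝ => (G (t * z0)).re) (G' z0 * z0).re 1 :=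
      reCLM.hasFDerivAt.comp_hasDerivAt (1:ℝ) hd
    have hq : HasDerivAt (fun t : ℝ => 2 * ((1 - t) / (1 + t))) (-1) 1 := by
      have := ((((hasDerivAt_id (1:ℝ)).const_sub 1).div ((hasDerivAt_id (1:ℝ)).const_add 1)
        (by norm_num)).const_mul 2)
      exact this.congr_deriv (by norm_num)
    have hdd := hdr.sub hq
    have hw := (hdd.hasDerivWithinAt (s := Set.Iio 1))
    rw [hasDerivWithinAt_iff_tendsto_slope' (by simp)] at hw
    have : (G' z0 * z0).re - -1 ≤ 0 := by
      refine le_of_tendsto hw ?_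
      have hev : ∀ᶠ t in nhdsWithin (1:ℝ) (Set.Iio 1), t ∈ Set.Ioo (0:ℝ) 1 :=
        Ioo_mem_nhdsLT (by norm_num)
      filter_upwards [hev] with t ht
      have hh := harnack_aux (K := fun z => (G z + 2) / 2) (R := ‖z0‖) (z := t * z0)
        ((hdG.add_const 2).div_const 2)
        (by simp [hG0]) (by
          intro w hw
          have := hgt w hw
          simp; linarith) (by
          simp [abs_of_pos ht.1]; nlinarith [ht.2])
      simp [abs_of_pos ht.1] at hh
      have h3 : (‖z0‖ - t * ‖z0‖) / (‖z0‖ + t * ‖z0‖) = (1 - t) / (1 + t) := by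
        have := ht.1
        field_simp
      rw [h3] at hh
      rw [slope_def_field]
      apply div_nonpos_of_nonneg_of_nonpos
      · simp [heq]; linarith
      · linarith [ht.2]
    rw [mul_comm]; linarith
  have := hs z0 hz0b
  rw [mem_slitPlane_iff] at this
  rcases this with h | h
  · simp only [add_re, one_re] at h; linarith
  · apply h; simp only [add_im, one_im]; linarith

lemma log_aux {G G' : ℂ → ℂ} (hG : ∀ z ∈ ball (0:ℂ) 1, HasDerivAt G (G' z) z) (hG0 : G 0 = 0)
    {q : ℂ → ℂ} (hq : DifferentiableOn ℂ q (ball 0 1)) (hq0 : q 0 = 1)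
    (hpos : ∀ z ∈ ball (0:ℂ) 1, 0 < (q z).re)
    (hs : ∀ z ∈ ball (0:ℂ) 1, z * G' z + 1 = q z) {z : ℂ} (hz : z ∈ ball (0:ℂ) 1) :
    -2 * Real.log 2 ≤ (G z).re := by
  have hz1 : ‖z‖ < 1 := by simpa using hz
  have hmem : ∀ t ∈ Set.Icc (0:ℝ) 1, (t:ℂ) * z ∈ ball (0:ℂ) 1 := by
    intro t ht
    simp [abs_of_nonneg ht.1]
    nlinarith [ht.2, norm_nonneg z]
  have hdr : ∀ t ∈ Set.Icc (0:ℝ) 1, HasDerivAt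
      (fun t : ℝ => (G (t * z)).re + 2 * Real.log (1 + t * ‖z‖))
      ((G' (t * z) * z).re + 2 * (‖z‖ / (1 + t * ‖z‖))) t := by
    intro t ht
    have h1 : HasDerivAt (fun t : ℝ => (t:ℂ) * z) z t := by
      have := ((hasDerivAt_id t).ofReal_comp).mul_const z
      simpa using this
    have h3 : HasDerivAt (fun t : ℝ => G (t * z)) (G' (t * z) * z) t :=
      HasDerivAt.comp (h := fun t : ℝ => (t:ℂ) * z) t (hG _ (hmem t ht)) h1
    have h4 : HasDerivAt (fun t : ℝ => (G (t * z)).re) (G' (t * z) * z).re t :=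
      reCLM.hasFDerivAt.comp_hasDerivAt t h3
    have h5 : HasDerivAt (fun t : ℝ => 1 + t * ‖z‖) ‖z‖ t := by
      simpa using ((hasDerivAt_id t).mul_const ‖z‖).const_add 1
    exact h4.add ((h5.log (by have := ht.1; positivity)).const_mul 2)
  have hmono : MonotoneOn (fun t : ℝ => (G (t * z)).re + 2 * Real.log (1 + t * ‖z‖))
      (Set.Icc 0 1) := by
    apply monotoneOn_of_deriv_nonneg (convex_Icc 0 1)
    · exact fun t ht => (hdr t ht).continuousAt.continuousWithinAt
    · exact fun t ht => (hdr t (interior_subset ht)).differentiableAt.differentiableWithinAt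
    · intro t ht
      rw [(hdr t (interior_subset ht)).deriv]
      rw [interior_Icc] at ht
      have hm := hmem t ⟨ht.1.le, ht.2.le⟩
      have hh := harnack_aux hq hq0 hpos hm
      rw [← hs _ hm] at hh
      simp only [norm_mul, norm_real, Real.norm_eq_abs, abs_of_pos ht.1] at hh
      have e : ((t:ℂ) * z * G' (t * z) + 1).re = t * (G' (t * z) * z).re + 1 := by
        rw [add_re, one_re, mul_assoc, re_ofReal_mul, mul_comm z]
      rw [e] at hh
      have hp : 0 < 1 + t * ‖z‖ := by have := ht.1; positivity
      have e2 : (1 - t * ‖z‖) / (1 + t * ‖z‖) = 1 - t * (2 * (‖z‖ / (1 + t * ‖z‖))) := by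
        field_simp; ring
      rw [e2] at hh
      have : 0 ≤ t * ((G' (t * z) * z).re + 2 * (‖z‖ / (1 + t * ‖z‖))) := by linarith
      exact nonneg_of_mul_nonneg_right this ht.1
  have := hmono (by simp : (0:ℝ) ∈ Set.Icc (0:ℝ) 1) (by simp : (1:ℝ) ∈ Set.Icc (0:ℝ) 1) zero_le_one
  simp [hG0] at this
  have hl : Real.log (1 + ‖z‖) ≤ Real.log 2 := Real.log_le_log (by positivity) (by linarith)
  linarith

lemma prim_aux {F : ℂ → ℂ} (hF : DifferentiableOn ℂ F (ball 0 1)) (hF0 : F 0 = 1) :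
    ∃ G : ℂ → ℂ, G 0 = 0 ∧ (∀ z ∈ ball (0:ℂ) 1, HasDerivAt G (dslope F 0 z) z) ∧
      ∀ z, z * dslope F 0 z + 1 = F z := by
  have hd : DifferentiableOn ℂ (dslope F 0) (ball 0 1) :=
    (differentiableOn_dslope (ball_mem_nhds _ one_pos)).2 hF
  obtain ⟨G, hG0, hG⟩ := hd.isExactOn_ball.with_val_at 0 0
  refine ⟨G, hG0, hG, fun z => ?_⟩
  have := sub_smul_dslope F 0 z
  simp [hF0] at this
  rw [this]; ring

lemma slit_aux {a b : ℂ} (ha : 0 < a.re) (hb : 0 < b.re) : a * b ∈ slitPlane := by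
  rw [mem_slitPlane_iff]
  by_contra! hc
  obtain ⟨h1, h2⟩ := hc
  simp only [mul_re, mul_im] at h1 h2
  have : 0 < a.re * b.re := mul_pos ha hb
  have h3 : a.re * b.im * (a.im * b.re) = - (a.im * b.re)^2 := by
    have : a.re * b.im = - (a.im * b.re) := by linarith
    rw [this]; ring
  have h4 : (a.im * b.im) * (a.re * b.re) ≤ 0 := by nlinarith [sq_nonneg (a.im * b.re)]
  nlinarith

lemma hg_lower (α : ℝ) (hα0 : 0 ≤ α) (hα1 : α < 1)
    (h g : ℂ → ℂ)
    (hh : DifferentiableOn ℂ h (ball 0 1))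
    (hg : DifferentiableOn ℂ g (ball 0 1))
    (hh0 : h 0 = 1) (hg0 : g 0 = 1)
    (hhne : ∀ z ∈ ball (0:ℂ) 1, h z ≠ 0)
    (hgne : ∀ z ∈ ball (0:ℂ) 1, g z ≠ 0)
    (hsp : ∀ z ∈ ball (0:ℂ) 1,
      ‖z * deriv g z / g z‖ < ‖1 + z * deriv h z / h z‖)
    (hstar : ∀ z ∈ ball (0:ℂ) 1, z ≠ 0 →
      α < (1 + z * deriv h z / h z - (starRingEnd ℂ) (z * deriv g z / g z)).re)
    {z : ℂ} (hz : z ∈ ball (0:ℂ) 1) :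
    1 / ((2:ℝ) ^ (2 * α) * Real.exp (2 * (1 - α))) ≤ ‖h z‖ * ‖g z‖ := by
  have hdh := hh.deriv isOpen_ball
  have hdg := hg.deriv isOpen_ball
  have hid : DifferentiableOn ℂ (fun z : ℂ => z) (ball 0 1) := differentiableOn_id
  set u : ℂ → ℂ := fun z => 1 + z * deriv h z / h z with hu
  set v : ℂ → ℂ := fun z => z * deriv g z / g z with hv
  have hud : DifferentiableOn ℂ u (ball 0 1) := ((hid.mul hdh).div hh hhne).const_add 1
  have hvd : DifferentiableOn ℂ v (ball 0 1) := (hid.mul hdg).div hg hgne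
  have hu0 : u 0 = 1 := by simp [hu]
  have hv0 : v 0 = 0 := by simp [hv]
  set p : ℂ → ℂ := fun z => u z - v z with hp
  have hpα : ∀ z ∈ ball (0:ℂ) 1, α < (p z).re := by
    intro z hz
    by_cases h0 : z = 0
    · subst h0; simp [hp, hu0, hv0, hα1]
    · have := hstar z hz h0
      rw [sub_re, conj_re] at this
      simpa only [hp, hu, hv, sub_re] using this
  have hpne : ∀ z ∈ ball (0:ℂ) 1, p z ≠ 0 := by
    intro z hz h0
    have := hpα z hz
    rw [h0] at this; simp at this; linarith
  have hpd : DifferentiableOn ℂ p (ball 0 1) := hud.sub hvd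
  set q : ℂ → ℂ := fun z => (u z + v z) / p z with hq
  have hqd : DifferentiableOn ℂ q (ball 0 1) := (hud.add hvd).div hpd hpne
  have hq0 : q 0 = 1 := by simp [hq, hp, hu0, hv0]
  have hqpos : ∀ z ∈ ball (0:ℂ) 1, 0 < (q z).re := by
    intro z hz
    have h1 : ‖v z‖ < ‖u z‖ := hsp z hz
    have h2 : 0 < normSq (p z) := normSq_pos.2 (hpne z hz)
    have h3 : ‖v z‖^2 < ‖u z‖^2 := by gcongr
    rw [← normSq_eq_norm_sq, ← normSq_eq_norm_sq, normSq_apply, normSq_apply] at h3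
    simp only [hq, div_re]
    rw [← add_div]
    apply div_pos _ h2
    simp only [hp, add_re, add_im, sub_re, sub_im]
    nlinarith
  set p1 : ℂ → ℂ := fun z => (p z - α) / (1 - α) with hp1
  have h1α : (1 - (α:ℂ)) ≠ 0 := by
    have : ((1 - α : ℝ) : ℂ) ≠ 0 := ofReal_ne_zero.2 (by linarith)
    simpa using this
  have hp10 : p1 0 = 1 := by simp [hp1, hp, hu0, hv0, h1α]
  have hp1pos : ∀ z ∈ ball (0:ℂ) 1, 0 < (p1 z).re := by
    intro z hz
    have e : p1 z = (p z - α) / ((1 - α : ℝ) : ℂ) := by simp [hp1]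
    rw [e, div_ofReal_re]
    apply div_pos _ (by linarith)
    simpa using hpα z hz
  have hp1d : DifferentiableOn ℂ p1 (ball 0 1) := (hpd.sub_const _).div_const _
  obtain ⟨Q, hQ0, hQ, hQ'⟩ := prim_aux hqd hq0
  obtain ⟨M, hM0, hM, hM'⟩ := prim_aux (hp1d.mul hqd) (by simp [hp10, hq0])
  have bQ := log_aux hQ hQ0 hqd hq0 hqpos (fun z _ => hQ' z) hz
  have bM := jack_aux hM hM0 (fun z hz => by
    rw [hM']; exact slit_aux (hp1pos z hz) (hqpos z hz)) hz
  set L : ℂ → ℂ := fun z => α * Q z + (1 - α) * M z with hL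
  have hLd : ∀ z ∈ ball (0:ℂ) 1, z ≠ 0 →
      HasDerivAt L (deriv h z / h z + deriv g z / g z) z := by
    intro z hz hz0
    have := ((hQ z hz).const_mul (α:ℂ)).add ((hM z hz).const_mul (1 - (α:ℂ)))
    refine this.congr_deriv ?_
    apply mul_left_cancel₀ hz0
    have e1 := hQ' z
    have e2 := hM' z
    have e3 : α * q z + (1 - α) * (p1 z * q z) = u z + v z := by
      have : p1 z * (1 - α) = p z - α := div_mul_cancel₀ _ h1α
      have h5 : q z * p z = u z + v z := div_mul_cancel₀ _ (hpne z hz)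
      linear_combination q z * this + h5
    simp only [Pi.mul_apply] at e2
    rw [← e1] at e3
    simp only [hu, hv] at e3
    rw [e1] at e3
    linear_combination (α:ℂ) * e1 + (1 - (α:ℂ)) * e2 + e3
  have hLc : ∀ z ∈ ball (0:ℂ) 1, DifferentiableAt ℂ L z := fun z hz =>
    (((hQ z hz).const_mul (α:ℂ)).add ((hM z hz).const_mul (1 - (α:ℂ)))).differentiableAt
  -- `h g exp(-L)` is constant
  set E : ℂ → ℂ := fun z => h z * g z * exp (- L z) with hE
  have hEd : DifferentiableOn ℂ E (ball 0 1) := by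
    intro z hz
    exact ((hh z hz).mul (hg z hz)).mul ((hLc z hz).neg.cexp.differentiableWithinAt)
  have hE0 : ∀ z ∈ ball (0:ℂ) 1, z ≠ 0 → deriv E z = 0 := by
    intro z hz hz0
    have a1 := (hh.differentiableAt (isOpen_ball.mem_nhds hz)).hasDerivAt
    have a2 := (hg.differentiableAt (isOpen_ball.mem_nhds hz)).hasDerivAt
    have a3 := ((a1.mul a2).mul (hLd z hz hz0).neg.cexp)
    have := a3.deriv
    have n1 := hhne z hz
    have n2 := hgne z hz
    refine Eq.trans this ?_
    simp only [Pi.mul_apply, Pi.neg_apply]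
    field_simp
    ring
  have hE0' : ∀ z ∈ ball (0:ℂ) 1, deriv E z = 0 := by
    intro z hz
    by_cases hz0 : z = 0
    · subst hz0
      have c1 : ContinuousAt (deriv E) 0 :=
        (hEd.deriv isOpen_ball).continuousOn.continuousAt (ball_mem_nhds _ one_pos)
      have c2 : Filter.Tendsto (deriv E) (nhdsWithin 0 {0}ᶜ) (nhds (deriv E 0)) :=
        c1.tendsto.mono_left nhdsWithin_le_nhds
      have c3 : Filter.Tendsto (deriv E) (nhdsWithin 0 {0}ᶜ) (nhds 0) := by
        refine tendsto_const_nhds.congr' ?_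
        filter_upwards [self_mem_nhdsWithin, mem_nhdsWithin_of_mem_nhds (ball_mem_nhds (0:ℂ) one_pos)]
          with w hw hw'
        exact (hE0 w hw' hw).symm
      exact tendsto_nhds_unique c2 c3
    · exact hE0 z hz hz0
  have hEc : E z = E 0 := by
    refine isOpen_ball.is_const_of_deriv_eq_zero (convex_ball (0:ℂ) 1).isPreconnected hEd ?_ hz
      (by simp)
    intro w hw; exact hE0' w hw
  have hfin : ‖h z‖ * ‖g z‖ = Real.exp (L z).re := by
    have : h z * g z = exp (L z) := by
      have e : E 0 = 1 := by simp [hE, hL, hh0, hg0, hQ0, hM0]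
      rw [e] at hEc
      simp only [hE, exp_neg] at hEc
      exact (mul_inv_eq_one₀ (exp_ne_zero _)).1 hEc
    rw [← norm_mul, this, norm_exp]
  rw [hfin, Real.rpow_def_of_pos two_pos, ← Real.exp_add, one_div, ← Real.exp_neg]
  apply Real.exp_le_exp.2
  have e : (L z).re = α * (Q z).re + (1 - α) * (M z).re := by
    have : L z = (α:ℂ) * Q z + ((1 - α : ℝ):ℂ) * M z := by simp [hL]
    rw [this, add_re, re_ofReal_mul, re_ofReal_mul]
  rw [e]
  nlinarith

lemma map_nhds_aux {h g : ℂ → ℂ}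
    (hh : DifferentiableOn ℂ h (ball 0 1))
    (hg : DifferentiableOn ℂ g (ball 0 1))
    (hhne : ∀ z ∈ ball (0:ℂ) 1, h z ≠ 0)
    (hgne : ∀ z ∈ ball (0:ℂ) 1, g z ≠ 0)
    (hsp : ∀ z ∈ ball (0:ℂ) 1,
      ‖z * deriv g z / g z‖ < ‖1 + z * deriv h z / h z‖) {z : ℂ} (hz : z ∈ ball (0:ℂ) 1) :
    Filter.map (fun z => z * h z * (starRingEnd ℂ) (g z)) (nhds z) =
      nhds (z * h z * (starRingEnd ℂ) (g z)) := by
  have s1 : HasStrictDerivAt h (deriv h z) z :=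
    (hh.analyticAt (isOpen_ball.mem_nhds hz)).hasStrictDerivAt
  have s2 : HasStrictDerivAt g (deriv g z) z :=
    (hg.analyticAt (isOpen_ball.mem_nhds hz)).hasStrictDerivAt
  have t1 : HasStrictFDerivAt (fun z => z * h z)
      (((ContinuousLinearMap.toSpanSingleton ℂ (1 * h z + z * deriv h z)).restrictScalars ℝ)) z :=
    ((hasStrictDerivAt_id z).mul s1).hasStrictFDerivAt.restrictScalars ℝ
  have t2 : HasStrictFDerivAt (fun z => (starRingEnd ℂ) (g z))
      ((conjCLE : ℂ →L[ℝ] ℂ).comp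
        ((ContinuousLinearMap.toSpanSingleton ℂ (deriv g z)).restrictScalars ℝ)) z :=
    (conjCLE : ℂ →L[ℝ] ℂ).hasStrictFDerivAt.comp z (s2.hasStrictFDerivAt.restrictScalars ℝ)
  have t3 := t1.mul t2
  refine t3.map_nhds_eq_of_surj ?_
  rw [LinearMap.range_eq_top]
  refine LinearMap.surjective_of_injective ?_
  rw [← LinearMap.ker_eq_bot, LinearMap.ker_eq_bot']
  intro w hw
  by_contra hw0
  have n1 := hhne z hz
  have n2 := hgne z hz
  have hw1 : z * h z * (starRingEnd ℂ) (w * deriv g z) +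
    (starRingEnd ℂ) (g z) * (w * (h z + z * deriv h z)) = 0 := by
    simpa using hw
  have hw2 := congrArg norm (eq_neg_of_add_eq_zero_left hw1)
  simp only [norm_mul, norm_neg, RCLike.norm_conj] at hw2
  have hlt := hsp z hz
  have e1 : 1 + z * deriv h z / h z = (h z + z * deriv h z) / h z := by field_simp
  rw [e1, norm_div, norm_div, norm_mul, div_lt_div_iff₀ (norm_pos_iff.2 n2) (norm_pos_iff.2 n1)] at hlt
  have : 0 < ‖w‖ := norm_pos_iff.2 hw0
  nlinarith

/-- For `f(z) = z h(z) conj(g z)` log-harmonic starlike of order `α`,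
one has `1/(2^{2α} e^{2(1-α)}) ≤ d(0, ∂ f(𝔻)) ≤ 1`. -/
theorem stmt_4 (α : ℝ) (hα0 : 0 ≤ α) (hα1 : α < 1)
    (h g : ℂ → ℂ)
    (hh : DifferentiableOn ℂ h (ball 0 1))
    (hg : DifferentiableOn ℂ g (ball 0 1))
    (hh0 : h 0 = 1) (hg0 : g 0 = 1)
    (hhne : ∀ z ∈ ball (0:ℂ) 1, h z ≠ 0)
    (hgne : ∀ z ∈ ball (0:ℂ) 1, g z ≠ 0)
    (hsp : ∀ z ∈ ball (0:ℂ) 1,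
      ‖z * deriv g z / g z‖ < ‖1 + z * deriv h z / h z‖)
    (hinj : Set.InjOn (fun z => z * h z * (starRingEnd ℂ) (g z)) (ball 0 1))
    (hstar : ∀ z ∈ ball (0:ℂ) 1, z ≠ 0 →
      α < (1 + z * deriv h z / h z - (starRingEnd ℂ) (z * deriv g z / g z)).re) :
    1 / ((2:ℝ) ^ (2 * α) * Real.exp (2 * (1 - α))) ≤
        infDist 0 (frontier ((fun z => z * h z * (starRingEnd ℂ) (g z)) '' ball 0 1)) ∧
      infDist 0 (frontier ((fun z => z * h z * (starRingEnd ℂ) (g z)) '' ball 0 1)) ≤ 1 := by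
  set f : ℂ → ℂ := fun z => z * h z * (starRingEnd ℂ) (g z) with hf
  set c : ℝ := 1 / ((2:ℝ) ^ (2 * α) * Real.exp (2 * (1 - α))) with hc
  have hc0 : 0 < c := by positivity
  have hnorm : ∀ z, ‖f z‖ = ‖z‖ * (‖h z‖ * ‖g z‖) := by
    intro z; simp [hf, mul_assoc]
  have hlow : ∀ z ∈ ball (0:ℂ) 1, ‖z‖ * c ≤ ‖f z‖ := by
    intro z hz
    rw [hnorm]
    exact mul_le_mul_of_nonneg_left
      (hg_lower α hα0 hα1 h g hh hg hh0 hg0 hhne hgne hsp hstar hz) (norm_nonneg _)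
  have hmap : ∀ z ∈ ball (0:ℂ) 1, Filter.map f (nhds z) = nhds (f z) := fun z hz =>
    map_nhds_aux hh hg hhne hgne hsp hz
  have hcont : ContinuousOn f (ball 0 1) := by
    intro z hz
    have : ContinuousAt f z := (hmap z hz).le
    exact this.continuousWithinAt
  have hopen : IsOpen (f '' ball 0 1) := by
    rw [isOpen_iff_mem_nhds]
    rintro _ ⟨z, hz, rfl⟩
    rw [← hmap z hz]
    exact Filter.image_mem_map (isOpen_ball.mem_nhds hz)
  have hlowF : ∀ w ∈ frontier (f '' ball 0 1), c ≤ ‖w‖ := by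
    intro w hw
    rw [hopen.frontier_eq] at hw
    by_contra! hlt
    obtain ⟨ρ, hρ1, hρ2⟩ := exists_between hlt
    have hρc : ρ / c < 1 := (div_lt_one hc0).2 hρ2
    have hsubb : closedBall (0:ℂ) (ρ / c) ⊆ ball 0 1 := closedBall_subset_ball hρc
    have hK : IsCompact (f '' closedBall 0 (ρ / c)) :=
      (isCompact_closedBall _ _).image_of_continuousOn (hcont.mono hsubb)
    apply hw.2
    apply Set.image_mono hsubb
    rw [← hK.isClosed.closure_eq]
    have hwc := hw.1
    rw [mem_closure_iff_nhds] at hwc ⊢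
    intro t ht
    have hb : ball (0:ℂ) ρ ∈ nhds w := isOpen_ball.mem_nhds (by simpa using hρ1)
    obtain ⟨y, ⟨hy1, hy2⟩, ⟨x, hx, rfl⟩⟩ := hwc _ (Filter.inter_mem ht hb)
    refine ⟨f x, hy1, x, ?_, rfl⟩
    have h1 := hlow x hx
    have h2 : ‖f x‖ < ρ := by simpa using hy2
    rw [mem_closedBall_zero_iff, le_div_iff₀ hc0]
    linarith
  have hupF : ∃ w ∈ frontier (f '' ball 0 1), ‖w‖ ≤ 1 := by
    by_contra! hno
    have hsub : closedBall (0:ℂ) 1 ⊆ f '' ball 0 1 := by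
      refine (convex_closedBall (0:ℂ) 1).isPreconnected.subset_of_closure_inter_subset hopen
        ⟨0, by simp, 0, by simp, by simp [hf]⟩ ?_
      rintro w ⟨hw1, hw2⟩
      by_contra hn
      have := hno w (by rw [hopen.frontier_eq]; exact ⟨hw1, hn⟩)
      simp at hw2
      linarith
    set F : ball (0:ℂ) 1 → ℂ := fun z => f z with hF
    have hFc : Continuous F := continuousOn_iff_continuous_domRestrict.1 hcont
    have hFi : Function.Injective F := fun a b hab => Subtype.ext (hinj a.2 b.2 hab)
    have hFo : IsOpenMap F := by
      intro s hs
      have hs' : IsOpen (Subtype.val '' s) := isOpen_ball.isOpenMap_subtype_val s hs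
      rw [isOpen_iff_mem_nhds]
      rintro _ ⟨z, hz, rfl⟩
      have : F '' s = f '' (Subtype.val '' s) := by rw [Set.image_image]
      rw [this]
      change _ ∈ nhds (f z)
      rw [← hmap z z.2]
      exact Filter.image_mem_map (hs'.mem_nhds ⟨z, hz, rfl⟩)
    have hemb : Topology.IsOpenEmbedding F := .of_continuous_injective_isOpenMap hFc hFi hFo
    have hKr : closedBall (0:ℂ) 1 ⊆ Set.range F := by
      intro w hw
      obtain ⟨z, hz, rfl⟩ := hsub hw
      exact ⟨⟨z, hz⟩, rfl⟩
    have hcomp := hemb.isInducing.isCompact_preimage' (isCompact_closedBall (0:ℂ) 1) hKr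
    obtain ⟨z0, hz0, hmax⟩ := hcomp.exists_isMaxOn (f := fun z => ‖(z:ℂ)‖)
      ⟨⟨0, by simp⟩, by simp [hF, hf]⟩ (by fun_prop)
    have hz01 : ‖(z0:ℂ)‖ < 1 := mem_ball_zero_iff.1 z0.2
    obtain ⟨r, hr1, hr2⟩ := exists_between hz01
    have hr0 : 0 < r := (norm_nonneg _).trans_lt hr1
    have hrs : closedBall (0:ℂ) r ⊆ ball 0 1 := closedBall_subset_ball hr2
    have hbig : ∀ z ∈ sphere (0:ℂ) r, 1 < ‖f z‖ := by
      intro z hz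
      by_contra! hle
      have hzr : ‖z‖ = r := by simpa using hz
      have := hmax (show (⟨z, hrs (sphere_subset_closedBall hz)⟩ : ball (0:ℂ) 1) ∈
        F ⁻¹' closedBall 0 1 by simpa [hF] using hle)
      simp at this
      linarith
    have hdiff : DifferentiableOn ℂ (fun z => (h z * g z)⁻¹) (closedBall 0 r) :=
      ((hh.mul hg).inv (fun z hz => mul_ne_zero (hhne z hz) (hgne z hz))).mono hrs
    have hm := norm_le_of_forall_mem_frontier_norm_le (C := r) (z := 0) isBounded_ball
      (hdiff.diffContOnCl_ball subset_rfl) (by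
        intro z hz
        rw [frontier_ball _ hr0.ne'] at hz
        have h1 := hbig z hz
        have hzr : ‖z‖ = r := by simpa using hz
        rw [hnorm, hzr] at h1
        have hp : 0 < ‖h z‖ * ‖g z‖ := by
          by_contra! hc; nlinarith
        rw [norm_inv, norm_mul, inv_le_iff_one_le_mul₀ hp]
        exact h1.le) (subset_closure (by simpa using hr0))
    simp [hh0, hg0] at hm
    linarith
  obtain ⟨w, hw, hw1⟩ := hupF
  constructor
  · rw [le_infDist ⟨w, hw⟩]
    intro y hy
    simpa using hlowF y hy
  · refine (infDist_le_dist_of_mem hw).trans ?_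
    simpa using hw1
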